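/- arXiv:1310.8182 — 2 statements merged into one kernel-verified Lean document; each statement's English description precedes it below -/
import Mathlib

section
/- Let n ≥ 1 and let S ⊆ ℕ^n be a set which is not strongly ultimately periodic (not STRUP). For q ≥ 1 and finite sets X, Y ⊆ [0, q), define FF_q(X,Y) to hold if for all sets Z_1, …, Z_n ⊆ [0, q) and every i ∈ [1,n], if Z_i ∩ (X ∪ Y) = ∅ then (|Z_1|, …, |Z_{i−1}|, |Z_i ∪ X|, |Z_{i+1}|, …, |Z_n|) ∈ S iff (|Z_1|, …, |Z_{i−1}|, |Z_i ∪ Y|, |Z_{i+1}|, …, |Z_n|) ∈ S; and define φ_q(X,Y) to hold if FF_q(X,Y) holds, there is no proper subset X' ⊊ X with FF_q(X',Y), and there is no proper subset Y' ⊊ Y with FF_q(X,Y'). Then for every k ≥ 1 there exists Q ≥ 1 such that for every q ≥ Q and all sets X, Y ⊆ [0, q) with |X| = |Y| ≤ k, the relation φ_q(X,Y) holds. -/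
/-- `S ⊆ ℕ^n` is `(m,p)`-strongly ultimately periodic. -/
def MuSTRUP {n : ℕ} (S : Set (Fin n → ℕ)) (m : ℕ) (p : Fin n → ℕ) : Prop :=
  (∀ i, 1 ≤ p i) ∧
    ∀ x : Fin n → ℕ, (∀ i, m ≤ x i) → ∀ j : Fin n,
      (x ∈ S ↔ Function.update x j (x j + p j) ∈ S)

/-- `S ⊆ ℕ^n` is strongly ultimately periodic. -/
def STRUP {n : ℕ} (S : Set (Fin n → ℕ)) : Prop :=
  ∃ (m : ℕ) (p : Fin n → ℕ), MuSTRUP S m p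

/-- The relation `FF_q(X,Y)` relative to `S ⊆ ℕ^n`, over the domain `[0,q)`. -/
def FFq (n q : ℕ) (S : Set (Fin n → ℕ)) (X Y : Finset ℕ) : Prop :=
  ∀ Z : Fin n → Finset ℕ, (∀ i, Z i ⊆ Finset.range q) →
    ∀ i : Fin n, Disjoint (Z i) (X ∪ Y) →
      (Function.update (fun j => (Z j).card) i ((Z i ∪ X).card) ∈ S ↔
       Function.update (fun j => (Z j).card) i ((Z i ∪ Y).card) ∈ S)

/-- The relation `φ_q(X,Y)`: `FF_q(X,Y)` holds and is minimal in both arguments. -/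
def Phiq (n q : ℕ) (S : Set (Fin n → ℕ)) (X Y : Finset ℕ) : Prop :=
  FFq n q S X Y ∧
    (¬ ∃ X' : Finset ℕ, X' ⊂ X ∧ FFq n q S X' Y) ∧
    (¬ ∃ Y' : Finset ℕ, Y' ⊂ Y ∧ FFq n q S X Y')

theorem FFq.symm {n q : ℕ} {S : Set (Fin n → ℕ)} {X Y : Finset ℕ} (h : FFq n q S X Y) :
    FFq n q S Y X :=
  fun Z hZ i hd => (h Z hZ i (by rwa [Finset.union_comm])).symm

theorem FFq.of_card_eq {n q : ℕ} {S : Set (Fin n → ℕ)} {X Y : Finset ℕ}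
    (h : X.card = Y.card) : FFq n q S X Y := by
  intro Z _ i hd
  rw [Finset.disjoint_union_right] at hd
  rw [Finset.card_union_of_disjoint hd.1, Finset.card_union_of_disjoint hd.2, h]

/-- `FF_q(X,Y)` makes `|Y| - |X|` a period of `S` in each coordinate, on a box of side about `q`. -/
theorem FFq.mem_iff {n q : ℕ} {S : Set (Fin n → ℕ)} {X Y : Finset ℕ} (h : FFq n q S X Y)
    (hXY : X.card ≤ Y.card) (x : Fin n → ℕ) (hx : ∀ j, x j + X.card + Y.card ≤ q)
    (i : Fin n) (hi : X.card ≤ x i) :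
    x ∈ S ↔ Function.update x i (x i + (Y.card - X.card)) ∈ S := by
  have hcard : x i - X.card ≤ (Finset.range q \ (X ∪ Y)).card := by
    have h1 := Finset.le_card_sdiff (X ∪ Y) (Finset.range q)
    have h2 := Finset.card_union_le X Y
    have h3 := hx i
    rw [Finset.card_range] at h1
    omega
  obtain ⟨A, hA, hAcard⟩ := Finset.exists_subset_card_eq hcard
  rw [Finset.subset_sdiff] at hA
  have hd := Finset.disjoint_union_right.1 hA.2
  have key := h (Function.update (fun j => Finset.range (x j)) i A) (fun j => by
      rcases eq_or_ne j i with rfl | hj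
      · simpa using hA.1
      · have := hx j
        simpa [hj] using (by omega : x j ≤ q)) i (by simpa using hA.2)
  have hZ (c : ℕ) : Function.update
      (fun j => (Function.update (fun j => Finset.range (x j)) i A j).card) i c =
      Function.update x i c := by
    ext j
    rcases eq_or_ne j i with rfl | hj
    · simp
    · simp [hj]
  rw [hZ, hZ, Function.update_self, Finset.card_union_of_disjoint hd.1,
    Finset.card_union_of_disjoint hd.2, hAcard, Nat.sub_add_cancel hi,
    Function.update_eq_self] at key
  rwa [show x i + (Y.card - X.card) = x i - X.card + Y.card by omega]

/-- If `S` is not STRUP then, for `q` large, `FF_q` fails on small sets of distinct sizes. -/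
theorem exists_forall_not_FFq {n : ℕ} {S : Set (Fin n → ℕ)} (hS : ¬ STRUP S) (k : ℕ) :
    ∃ Q : ℕ, ∀ q, Q ≤ q → ∀ X Y : Finset ℕ, X.card < Y.card → Y.card ≤ k →
      ¬ FFq n q S X Y := by
  have hfail (p : ℕ) : ∃ x : Fin n → ℕ, 1 ≤ p → (∀ i, k ≤ x i) ∧
      ∃ j, ¬ (x ∈ S ↔ Function.update x j (x j + p) ∈ S) := by
    by_contra! hp
    exact hS ⟨k, fun _ => p, fun _ => (hp 0).1, fun x hx j => (hp x).2 hx j⟩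
  choose x hx using hfail
  refine ⟨∑ p ∈ Finset.range (k + 1), ∑ j, x p j + 2 * k, fun q hq X Y hXY hY h => ?_⟩
  obtain ⟨hk, i, hi⟩ := hx (Y.card - X.card) (by omega)
  refine hi (h.mem_iff hXY.le _ (fun j => ?_) i (by have := hk i; omega))
  have h1 : x (Y.card - X.card) j ≤ ∑ j, x (Y.card - X.card) j :=
    Finset.single_le_sum (f := x (Y.card - X.card)) (fun _ _ => Nat.zero_le _)
      (Finset.mem_univ j)
  have h2 : ∑ j, x (Y.card - X.card) j ≤ ∑ p ∈ Finset.range (k + 1), ∑ j, x p j :=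
    Finset.single_le_sum (f := fun p => ∑ j, x p j) (fun _ _ => Nat.zero_le _)
      (Finset.mem_range.2 (by omega))
  omega

theorem stmt_8 (n : ℕ) (hn : 1 ≤ n) (S : Set (Fin n → ℕ)) (hS : ¬ STRUP S)
    (k : ℕ) (hk : 1 ≤ k) :
    ∃ Q : ℕ, 1 ≤ Q ∧ ∀ q : ℕ, Q ≤ q →
      ∀ X Y : Finset ℕ, X ⊆ Finset.range q → Y ⊆ Finset.range q →
        X.card = Y.card → Y.card ≤ k → Phiq n q S X Y := by
  obtain ⟨Q, hQ⟩ := exists_forall_not_FFq hS k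
  refine ⟨Q + 1, by omega, fun q hq X Y _ _ hXY hY => ⟨.of_card_eq hXY, ?_, ?_⟩⟩
  · rintro ⟨X', hX', h⟩
    exact hQ q (by omega) X' Y (hXY ▸ Finset.card_lt_card hX') hY h
  · rintro ⟨Y', hY', h⟩
    exact hQ q (by omega) Y' X (hXY ▸ Finset.card_lt_card hY') (hXY ▸ hY) h.symm
end

section
/- Let n ≥ 1 and let S ⊆ ℕ^n be a finite union of sets of the form E_1 × ⋯ × E_n where each E_i ⊆ ℕ is ultimately periodic. Then S is strongly ultimately periodic (STRUP). -/
/-- `E ⊆ ℕ` is ultimately periodic. -/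
def UltimatelyPeriodic (E : Set ℕ) : Prop :=
  ∃ M p : ℕ, 1 ≤ p ∧ ∀ x : ℕ, M ≤ x → (x ∈ E ↔ x + p ∈ E)

/-- `S ⊆ ℕ^n` is a finite union of products of ultimately periodic sets. -/
def FinUnionUPProducts {n : ℕ} (S : Set (Fin n → ℕ)) : Prop :=
  ∃ (k : ℕ) (E : Fin k → Fin n → Set ℕ),
    (∀ t i, UltimatelyPeriodic (E t i)) ∧
    S = ⋃ t : Fin k, {x : Fin n → ℕ | ∀ i, x i ∈ E t i}

/-- A period of `E` beyond `M` can be replaced by any of its multiples. -/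
theorem mem_iff_add_mul_mem_of_period {E : Set ℕ} {M p : ℕ}
    (h : ∀ x, M ≤ x → (x ∈ E ↔ x + p ∈ E)) (c : ℕ) {x : ℕ} (hx : M ≤ x) :
    x ∈ E ↔ x + p * c ∈ E := by
  induction c with
  | zero => simp
  | succ c ih => rw [ih, h _ (by omega), Nat.mul_succ, Nat.add_assoc]

/-- Finitely many ultimately periodic sets have a common threshold and a common period. -/
theorem exists_common_period {ι : Type*} [Fintype ι] {E : ι → Set ℕ}
    (hE : ∀ a, UltimatelyPeriodic (E a)) :
    ∃ m q : ℕ, 1 ≤ q ∧ ∀ a x, m ≤ x → (x ∈ E a ↔ x + q ∈ E a) := by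
  choose M p hp h using hE
  refine ⟨Finset.univ.sup M, ∏ a, p a, Nat.succ_le_of_lt (Finset.prod_pos fun a _ => hp a),
    fun a x hx => ?_⟩
  obtain ⟨c, hc⟩ := Finset.dvd_prod_of_mem p (Finset.mem_univ a)
  rw [hc]
  exact mem_iff_add_mul_mem_of_period (h a) c ((Finset.le_sup (Finset.mem_univ a)).trans hx)

theorem stmt_11 (n : ℕ) (hn : 1 ≤ n) (S : Set (Fin n → ℕ))
    (hS : FinUnionUPProducts S) : STRUP S := by
  obtain ⟨k, E, hE, rfl⟩ := hS
  obtain ⟨m, q, hq, h⟩ := exists_common_period (E := fun a : Fin k × Fin n => E a.1 a.2)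
    fun a => hE a.1 a.2
  refine ⟨m, fun _ => q, fun _ => hq, fun x hx j => ?_⟩
  simp only [Set.mem_iUnion, Set.mem_ofPred_eq]
  refine exists_congr fun t => forall_congr' fun i => ?_
  obtain rfl | hij := eq_or_ne i j
  · simpa using h (t, i) (x i) (hx i)
  · simp [hij]
end
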